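/- arXiv:1509.06332 — 4 statements merged into one kernel-verified Lean document; each statement's English description precedes it below -/
import Mathlib

section
/- Suppose c_j > 0 for every j ∈ {1,...,n}, d_j < 0 for every j ∈ {1,...,n}, and Σ_{j∈H} d_j + β > 0 for every pack H. Then every optimal pack of the linear fractional set packing problem is a prime pack. -/
open Finset

/-- `H` is a pack: the sets `S j` for `j ∈ H` are pairwise disjoint. -/
def IsPack {n m : ℕ} (S : Fin n → Finset (Fin m)) (H : Finset (Fin n)) : Prop :=
  (H : Set (Fin n)).Pairwise fun i j => Disjoint (S i) (S j)

/-- Objective value `Z(H) = (∑_{j∈H} c j) / (∑_{j∈H} d j + β)`. -/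
noncomputable def Zval {n : ℕ} (c d : Fin n → ℝ) (β : ℝ) (H : Finset (Fin n)) : ℝ :=
  (∑ j ∈ H, c j) / (∑ j ∈ H, d j + β)

/-- A pack is redundant if some additional index can be inserted keeping it a pack. -/
def IsRedundantPack {n m : ℕ} (S : Fin n → Finset (Fin m)) (H : Finset (Fin n)) : Prop :=
  IsPack S H ∧ ∃ j ∉ H, IsPack S (insert j H)

/-- A prime pack is a pack that is not redundant. -/
def IsPrimePack {n m : ℕ} (S : Fin n → Finset (Fin m)) (H : Finset (Fin n)) : Prop :=
  IsPack S H ∧ ¬ ∃ j ∉ H, IsPack S (insert j H)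

/-- An optimal pack maximizes `Z` over all packs. -/
def IsOptimalPack {n m : ℕ} (S : Fin n → Finset (Fin m)) (c d : Fin n → ℝ) (β : ℝ)
    (H : Finset (Fin n)) : Prop :=
  IsPack S H ∧ ∀ H' : Finset (Fin n), IsPack S H' → Zval c d β H' ≤ Zval c d β H

theorem optimal_pack_is_prime_of_pos_cost_neg_weight {n m : ℕ}
    (S : Fin n → Finset (Fin m)) (c d : Fin n → ℝ) (β : ℝ)
    (hc : ∀ j, 0 < c j) (hd : ∀ j, d j < 0)
    (hden : ∀ H : Finset (Fin n), IsPack S H → 0 < ∑ j ∈ H, d j + β)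
    (H : Finset (Fin n)) (hopt : IsOptimalPack S c d β H) :
    IsPrimePack S H := by
  obtain ⟨hH, hmax⟩ := hopt
  refine ⟨hH, ?_⟩
  rintro ⟨j, hj, hins⟩
  have hle := hmax _ hins
  have hpos := hden _ hins
  simp only [Zval, sum_insert hj] at hle hpos
  refine hle.not_gt (div_lt_div₀ ?_ ?_ ?_ hpos)
  · linarith [hc j]
  · linarith [hd j]
  · have := sum_nonneg fun i (_ : i ∈ H) => (hc i).le
    linarith [hc j]
end

section
/- Suppose c_j > 0 for every j ∈ {1,...,n}, d_j < 0 for every j ∈ {1,...,n}, Σ_{j∈H} d_j + β > 0 for every pack H, and there exists at least one pack (e.g., the empty set). Then there exists a pack H* that is optimal for the linear fractional set packing problem and is a prime pack. -/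
open Finset

/-- Inserting a new index of positive cost and negative weight strictly increases the objective. -/
lemma Zval_lt_Zval_insert {n : ℕ} {c d : Fin n → ℝ} {β : ℝ} {H : Finset (Fin n)} {j : Fin n}
    (hj : j ∉ H) (hc : ∀ i, 0 < c i) (hd : d j < 0)
    (hden : 0 < ∑ i ∈ insert j H, d i + β) :
    Zval c d β H < Zval c d β (insert j H) := by
  unfold Zval
  rw [sum_insert hj] at hden
  rw [sum_insert hj, sum_insert hj]
  have hcH : 0 ≤ ∑ i ∈ H, c i := sum_nonneg fun i _ => (hc i).le
  exact div_lt_div₀ (by linarith [hc j]) (by linarith) (by linarith [hc j]) hden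

theorem exists_optimal_prime_pack_of_pos_cost_neg_weight {n m : ℕ}
    (S : Fin n → Finset (Fin m)) (c d : Fin n → ℝ) (β : ℝ)
    (hc : ∀ j, 0 < c j) (hd : ∀ j, d j < 0)
    (hden : ∀ H : Finset (Fin n), IsPack S H → 0 < ∑ j ∈ H, d j + β)
    (hex : ∃ H : Finset (Fin n), IsPack S H) :
    ∃ H : Finset (Fin n), IsOptimalPack S c d β H ∧ IsPrimePack S H := by
  obtain ⟨H, hH, hmax⟩ := Set.exists_max_image {H | IsPack S H} (Zval c d β) (Set.toFinite _) hex
  refine ⟨H, ⟨hH, hmax⟩, hH, ?_⟩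
  rintro ⟨j, hj, hins⟩
  exact (hmax _ hins).not_gt (Zval_lt_Zval_insert hj hc (hd j) (hden _ hins))
end

section
/- Suppose that Σ_{j∈H} d_j + β > 0 for every pack H, and that for every pair of packs H₁ ⊊ H₂ one has Σ_{j∈H₂∖H₁} d_j > 0 and (Σ_{j∈H₂∖H₁} c_j)/(Σ_{j∈H₂∖H₁} d_j) > Z(H₁). Then every optimal pack of the linear fractional set packing problem is a prime pack. -/
open Finset

/-- If the marginal ratio of `H₂ \ H₁` exceeds the objective value at `H₁`, then passing from `H₁`
to the larger set `H₂` strictly increases the objective value. -/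
theorem Zval_lt_Zval_of_lt_sdiff_ratio {n : ℕ} {c d : Fin n → ℝ} {β : ℝ} {H₁ H₂ : Finset (Fin n)}
    (hsub : H₁ ⊆ H₂) (hden : 0 < ∑ j ∈ H₁, d j + β) (hd : 0 < ∑ j ∈ H₂ \ H₁, d j)
    (hratio : Zval c d β H₁ < (∑ j ∈ H₂ \ H₁, c j) / (∑ j ∈ H₂ \ H₁, d j)) :
    Zval c d β H₁ < Zval c d β H₂ := by
  unfold Zval at *
  rw [← sum_sdiff hsub (f := c), ← sum_sdiff hsub (f := d), add_assoc]
  rw [div_lt_div_iff₀ hden hd] at hratio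
  rw [div_lt_div_iff₀ hden (add_pos hd hden)]
  linarith

theorem optimal_pack_is_prime_of_partial_ratio_cond {n m : ℕ}
    (S : Fin n → Finset (Fin m)) (c d : Fin n → ℝ) (β : ℝ)
    (hden : ∀ H : Finset (Fin n), IsPack S H → 0 < ∑ j ∈ H, d j + β)
    (hratio : ∀ H₁ H₂ : Finset (Fin n), IsPack S H₁ → IsPack S H₂ → H₁ ⊂ H₂ →
      0 < ∑ j ∈ H₂ \ H₁, d j ∧
        Zval c d β H₁ < (∑ j ∈ H₂ \ H₁, c j) / (∑ j ∈ H₂ \ H₁, d j))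
    (H : Finset (Fin n)) (hopt : IsOptimalPack S c d β H) :
    IsPrimePack S H := by
  refine ⟨hopt.1, ?_⟩
  rintro ⟨j, hj, hpack⟩
  obtain ⟨hd, hr⟩ := hratio H (insert j H) hopt.1 hpack (ssubset_insert hj)
  exact (hopt.2 _ hpack).not_gt
    (Zval_lt_Zval_of_lt_sdiff_ratio (subset_insert j H) (hden H hopt.1) hd hr)
end

section
/- Suppose there exist constants c > 0 and d ∈ ℝ such that c_j = c and d_j = d for all j ∈ {1,...,n}, and suppose |H|·d + β > 0 for every pack H. If H* is an optimal pack of the linear fractional set packing problem, then H* is a prime pack. -/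
open Finset

theorem optimal_pack_is_prime_of_const_pos_cost {n m : ℕ}
    (S : Fin n → Finset (Fin m)) (c d : Fin n → ℝ) (β : ℝ)
    (c₀ d₀ : ℝ) (hc₀ : 0 < c₀) (hc : ∀ j, c j = c₀) (hd : ∀ j, d j = d₀)
    (hden : ∀ H : Finset (Fin n), IsPack S H → 0 < (H.card : ℝ) * d₀ + β)
    (H : Finset (Fin n)) (hopt : IsOptimalPack S c d β H) :
    IsPrimePack S H := by
  refine ⟨hopt.1, ?_⟩
  rintro ⟨j, hj, hjH⟩
  have hβ : 0 < β := by simpa using hden ∅ (by simp [IsPack])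
  have hH := hden H hopt.1
  have hH' := hden _ hjH
  have hle := hopt.2 _ hjH
  simp only [Zval, hc, hd, sum_const, nsmul_eq_mul, card_insert_of_notMem hj,
    Nat.cast_add, Nat.cast_one] at hle hH'
  rw [div_le_div_iff₀ hH' hH] at hle
  nlinarith [mul_pos hc₀ hβ]
end
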